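/- arXiv:2409.17697 — 3 statements merged into one kernel-verified Lean document; each statement's English description precedes it below -/
import Mathlib

section
/- Let u : ℝ² → ℝ² be infinitely differentiable with compact support and divergence-free, i.e. ∂₁u₁(x) + ∂₂u₂(x) = 0 for every x ∈ ℝ². Then ∫_{ℝ²} ∑_{i,j=1}^{2} u_i(x) · ∂_i u_j(x) · (u_j(x) − Δu_j(x)) dx = 0, where Δu_j = ∂₁∂₁u_j + ∂₂∂₂u_j is the Laplacian of the j-th component. -/
open MeasureTheory

/-- The integral over `ℝⁿ` of a directional derivative of a compactly supported `C¹` function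
vanishes. -/
lemma integral_fderiv_apply_eq_zero {E : Type*} [NormedAddCommGroup E] [NormedSpace ℝ E]
    [FiniteDimensional ℝ E] [MeasurableSpace E] [BorelSpace E] (μ : Measure E)
    [μ.IsAddHaarMeasure] {F : E → ℝ} (hF : ContDiff ℝ 1 F) (hs : HasCompactSupport F) (v : E) :
    Integrable (fun x => fderiv ℝ F x v) μ ∧ ∫ x, fderiv ℝ F x v ∂μ = 0 := by
  have hint : Integrable (fun x => fderiv ℝ F x v) μ :=
    ((hF.continuous_fderiv one_ne_zero).clm_apply continuous_const).integrable_of_hasCompactSupport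
      (hs.fderiv_apply ℝ v)
  refine ⟨hint, ?_⟩
  have h := integral_mul_fderiv_eq_neg_fderiv_mul_of_integrable (μ := μ) (𝕜 := ℝ)
    (f := fun _ : E => (1 : ℝ)) (g := F) (v := v) (by simp) (by simpa using hint)
    (by simpa using hF.continuous.integrable_of_hasCompactSupport hs)
    (fun x _ => differentiableAt_const _) (fun x _ => hF.differentiable one_ne_zero x)
  simpa using h

/-- Directional derivatives of a `C²` function commute. -/
lemma fderiv_fderiv_apply_comm {E : Type*} [NormedAddCommGroup E] [NormedSpace ℝ E]
    {f : E → ℝ} (hf : ContDiff ℝ 2 f) (x v w : E) :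
    fderiv ℝ (fun y => fderiv ℝ f y v) x w = fderiv ℝ (fun y => fderiv ℝ f y w) x v := by
  have hd : DifferentiableAt ℝ (fderiv ℝ f) x :=
    (hf.fderiv_right (m := 1) (by norm_num)).differentiable one_ne_zero x
  have hsymm : IsSymmSndFDerivAt ℝ f x := hf.contDiffAt.isSymmSndFDerivAt (by simp)
  rw [fderiv_clm_apply hd (differentiableAt_const _), fderiv_clm_apply hd (differentiableAt_const _)]
  simpa using hsymm.eq w v

/-- The `k`-th component of a vector field whose divergence is the integrand of `b(u,u,Au)`
when `u = (a, b)` is divergence-free. -/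
noncomputable def flux (a b : EuclideanSpace ℝ (Fin 2) → ℝ) (k : Fin 2)
    (x : EuclideanSpace ℝ (Fin 2)) : ℝ :=
  ![a x, b x] k * ((1 / 2) * (a x * a x + b x * b x +
      (fderiv ℝ a x (EuclideanSpace.single 0 1) * fderiv ℝ a x (EuclideanSpace.single 0 1) +
       fderiv ℝ a x (EuclideanSpace.single 1 1) * fderiv ℝ a x (EuclideanSpace.single 1 1) +
       fderiv ℝ b x (EuclideanSpace.single 0 1) * fderiv ℝ b x (EuclideanSpace.single 0 1) +
       fderiv ℝ b x (EuclideanSpace.single 1 1) * fderiv ℝ b x (EuclideanSpace.single 1 1)))) -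
    ((a x * fderiv ℝ a x (EuclideanSpace.single 0 1) +
        b x * fderiv ℝ a x (EuclideanSpace.single 1 1)) * fderiv ℝ a x (EuclideanSpace.single k 1) +
      (a x * fderiv ℝ b x (EuclideanSpace.single 0 1) +
        b x * fderiv ℝ b x (EuclideanSpace.single 1 1)) * fderiv ℝ b x (EuclideanSpace.single k 1))

lemma contDiff_flux {a b : EuclideanSpace ℝ (Fin 2) → ℝ} (ha : ContDiff ℝ 2 a)
    (hb : ContDiff ℝ 2 b) (k : Fin 2) : ContDiff ℝ 1 (flux a b k) := by
  have ha₁ : ContDiff ℝ 1 a := ha.of_le (by norm_num)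
  have hb₁ : ContDiff ℝ 1 b := hb.of_le (by norm_num)
  have hda (v) : ContDiff ℝ 1 fun x => fderiv ℝ a x v :=
    (ha.fderiv_right (by norm_num)).clm_apply contDiff_const
  have hdb (v) : ContDiff ℝ 1 fun x => fderiv ℝ b x v :=
    (hb.fderiv_right (by norm_num)).clm_apply contDiff_const
  have hk : ContDiff ℝ 1 fun x => ![a x, b x] k := by fin_cases k <;> assumption
  unfold flux
  fun_prop

lemma hasCompactSupport_flux {a b : EuclideanSpace ℝ (Fin 2) → ℝ} (ha : HasCompactSupport a)
    (hb : HasCompactSupport b) (k : Fin 2) : HasCompactSupport (flux a b k) := by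
  refine HasCompactSupport.of_support_subset_isCompact (ha.isCompact.union hb.isCompact) ?_
  intro x hx
  by_contra hn
  rw [Set.mem_union, not_or] at hn
  apply hx
  have hax := image_eq_zero_of_notMem_tsupport hn.1
  have hbx := image_eq_zero_of_notMem_tsupport hn.2
  fin_cases k <;> simp [flux, hax, hbx]

/-- For divergence-free `u = (a, b)`, the integrand of `b(u,u,Au)` is a divergence. -/
lemma sum_fderiv_flux {a b : EuclideanSpace ℝ (Fin 2) → ℝ} (ha : ContDiff ℝ 2 a)
    (hb : ContDiff ℝ 2 b) (x : EuclideanSpace ℝ (Fin 2))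
    (hdiv : fderiv ℝ a x (EuclideanSpace.single 0 1) +
      fderiv ℝ b x (EuclideanSpace.single 1 1) = 0) :
    ∑ k, fderiv ℝ (flux a b k) x (EuclideanSpace.single k 1) =
      ∑ i, ∑ j, ![a, b] i x * fderiv ℝ (![a, b] j) x (EuclideanSpace.single i 1) *
        (![a, b] j x - ∑ k, fderiv ℝ (fun y => fderiv ℝ (![a, b] j) y
          (EuclideanSpace.single k 1)) x (EuclideanSpace.single k 1)) := by
  have hA : HasFDerivAt a (fderiv ℝ a x) x := (ha.differentiable two_ne_zero x).hasFDerivAt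
  have hB : HasFDerivAt b (fderiv ℝ b x) x := (hb.differentiable two_ne_zero x).hasFDerivAt
  have hDA (v) : HasFDerivAt (fun y => fderiv ℝ a y v) (fderiv ℝ (fun y => fderiv ℝ a y v) x) x :=
    (((ha.fderiv_right (m := 1) (by norm_num)).clm_apply contDiff_const).differentiable
      one_ne_zero x).hasFDerivAt
  have hDB (v) : HasFDerivAt (fun y => fderiv ℝ b y v) (fderiv ℝ (fun y => fderiv ℝ b y v) x) x :=
    (((hb.fderiv_right (m := 1) (by norm_num)).clm_apply contDiff_const).differentiable
      one_ne_zero x).hasFDerivAt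
  have hK (k : Fin 2) : HasFDerivAt (fun y => ![a y, b y] k)
      (![fderiv ℝ a x, fderiv ℝ b x] k) x := by fin_cases k <;> assumption
  have hflux (k : Fin 2) := ((hK k).mul (((((hA.mul hA).add (hB.mul hB)).add
    (((((hDA (EuclideanSpace.single 0 1)).mul (hDA (EuclideanSpace.single 0 1))).add
      ((hDA (EuclideanSpace.single 1 1)).mul (hDA (EuclideanSpace.single 1 1)))).add
      ((hDB (EuclideanSpace.single 0 1)).mul (hDB (EuclideanSpace.single 0 1)))).add
      ((hDB (EuclideanSpace.single 1 1)).mul (hDB (EuclideanSpace.single 1 1)))))).const_mul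
        (1 / 2))).sub
    ((((hA.mul (hDA (EuclideanSpace.single 0 1))).add
      (hB.mul (hDA (EuclideanSpace.single 1 1)))).mul (hDA (EuclideanSpace.single k 1))).add
    (((hA.mul (hDB (EuclideanSpace.single 0 1))).add
      (hB.mul (hDB (EuclideanSpace.single 1 1)))).mul (hDB (EuclideanSpace.single k 1))))
  have hF (k : Fin 2) := HasFDerivAt.fderiv (f := flux a b k) (hflux k)
  have ca := fderiv_fderiv_apply_comm ha x (EuclideanSpace.single 0 1) (EuclideanSpace.single 1 1)
  have cb := fderiv_fderiv_apply_comm hb x (EuclideanSpace.single 0 1) (EuclideanSpace.single 1 1)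
  simp only [Fin.sum_univ_two, hF]
  simp [ca, cb]
  rw [eq_neg_of_add_eq_zero_right hdiv]
  ring

/-- For a smooth, compactly supported, divergence-free vector field `u` on `ℝ²`,
`b(u,u,Au) = 0`, i.e.
`∫ ∑_{i,j} uᵢ ∂ᵢuⱼ (uⱼ - Δuⱼ) dx = 0`. -/
theorem stmt1 (u : EuclideanSpace ℝ (Fin 2) → EuclideanSpace ℝ (Fin 2))
    (hu : ContDiff ℝ (⊤ : ℕ∞) u) (hsupp : HasCompactSupport u)
    (hdiv : ∀ x, ∑ i, fderiv ℝ (fun y => u y i) x (EuclideanSpace.single i 1) = 0) :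
    (∫ x, ∑ i, ∑ j,
        u x i * fderiv ℝ (fun y => u y j) x (EuclideanSpace.single i 1) *
          (u x j - ∑ k, fderiv ℝ (fun y => fderiv ℝ (fun z => u z j) y
              (EuclideanSpace.single k 1)) x (EuclideanSpace.single k 1))) = 0 := by
  have hc (i : Fin 2) : ContDiff ℝ 2 fun x => u x i :=
    contDiff_euclidean.1 (hu.of_le (mod_cast le_top : ((2 : ℕ∞) : WithTop ℕ∞) ≤ _)) i
  have hsc (i : Fin 2) : HasCompactSupport fun x => u x i :=
    hsupp.comp_left (g := fun y : EuclideanSpace ℝ (Fin 2) => y i) rfl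
  have hzero (k : Fin 2) := integral_fderiv_apply_eq_zero volume
    (contDiff_flux (hc 0) (hc 1) k) (hasCompactSupport_flux (hsc 0) (hsc 1) k)
    (EuclideanSpace.single k 1)
  calc
    _ = ∫ x, ∑ k, fderiv ℝ (flux (fun x => u x 0) (fun x => u x 1) k) x
          (EuclideanSpace.single k 1) := by
      congr 1 with x
      rw [sum_fderiv_flux (hc 0) (hc 1) x (by simpa [Fin.sum_univ_two] using hdiv x)]
      simp [Fin.sum_univ_two]
    _ = 0 := by
      rw [integral_finsetSum _ fun k _ => (hzero k).1]
      exact Finset.sum_eq_zero fun k _ => (hzero k).2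
end

section
/- Let f : [0,∞) → ℝ be continuous and let a, b : [0,∞) → ℝ be locally Lebesgue integrable. Assume that f′ ≤ a·f + b holds in the distributional sense on (0,∞), i.e. for every nonnegative infinitely differentiable function φ : ℝ → ℝ with compact support contained in (0,∞), one has −∫₀^∞ f(t) φ′(t) dt ≤ ∫₀^∞ (a(t) f(t) + b(t)) φ(t) dt. Then for every t ≥ 0, f(t) ≤ e^{A(t)} · (f(0) + ∫₀ᵗ b(s) e^{−A(s)} ds), where A(t) := ∫₀ᵗ a(s) ds. -/
open MeasureTheory intervalIntegral
open Filter Topology Set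

/-- Post-composition with a function that is Lipschitz on the image preserves absolute
continuity. -/
theorem LipschitzOnWith.comp_absolutelyContinuousOnInterval {g f : ℝ → ℝ} {K : NNReal} {S : Set ℝ}
    {a b : ℝ} (hg : LipschitzOnWith K g S) (hf : AbsolutelyContinuousOnInterval f a b)
    (hS : MapsTo f (uIcc a b) S) : AbsolutelyContinuousOnInterval (fun x ↦ g (f x)) a b := by
  rw [absolutelyContinuousOnInterval_iff] at hf ⊢
  intro ε hε
  obtain ⟨δ, hδ, h⟩ := hf (ε / (K + 1)) (by positivity)
  refine ⟨δ, hδ, fun E hE hE' ↦ ?_⟩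
  have hlt := h E hE hE'
  rw [lt_div_iff₀ (by positivity)] at hlt
  refine lt_of_le_of_lt ?_ hlt
  rw [Finset.sum_mul]
  refine Finset.sum_le_sum fun i hi ↦ ?_
  have hmem := hE.1 i hi
  have := hg.dist_le_mul _ (hS hmem.1) _ (hS hmem.2)
  nlinarith [dist_nonneg (x := f (E.2 i).1) (y := f (E.2 i).2)]

theorem AbsolutelyContinuousOnInterval.exp {f : ℝ → ℝ} {a b : ℝ}
    (hf : AbsolutelyContinuousOnInterval f a b) :
    AbsolutelyContinuousOnInterval (fun x ↦ Real.exp (f x)) a b := by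
  obtain ⟨C, hC⟩ := hf.exists_bound
  obtain ⟨K, hK⟩ := (Real.contDiff_exp (n := 1)).contDiffOn.exists_lipschitzOnWith (by decide)
    (convex_Icc (-C) C) isCompact_Icc
  exact hK.comp_absolutelyContinuousOnInterval hf fun x hx ↦ abs_le.1 (hC x hx)

/-- The variation of constants formula solves the integrated linear equation `y' = a y + b`. -/
theorem variation_of_constants_sub_eq_integral {a b : ℝ → ℝ} {T c : ℝ}
    (ha : IntervalIntegrable a volume 0 T) (hb : IntervalIntegrable b volume 0 T)
    {y : ℝ → ℝ} (hy : y = fun t ↦ Real.exp (∫ s in (0:ℝ)..t, a s) *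
      (c + ∫ s in (0:ℝ)..t, b s * Real.exp (-(∫ r in (0:ℝ)..s, a r)))) :
    ContinuousOn y (uIcc 0 T) ∧ ∀ s ∈ uIcc 0 T, ∀ t ∈ uIcc 0 T,
      y t - y s = ∫ x in s..t, (a x * y x + b x) := by
  have hA := ha.absolutelyContinuousOnInterval_intervalIntegral (c := 0) left_mem_uIcc
  have hbE : IntervalIntegrable (fun s ↦ b s * Real.exp (-(∫ r in (0:ℝ)..s, a r))) volume 0 T :=
    hb.mul_continuousOn (Real.continuous_exp.comp_continuousOn hA.continuousOn.neg)
  have hB := hbE.absolutelyContinuousOnInterval_intervalIntegral (c := 0) left_mem_uIcc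
  have hcB : AbsolutelyContinuousOnInterval
      (fun t ↦ c + ∫ s in (0:ℝ)..t, b s * Real.exp (-(∫ r in (0:ℝ)..s, a r))) 0 T :=
    (contDiffOn_const (c := c)).absolutelyContinuousOnInterval.add hB
  have hyAC : AbsolutelyContinuousOnInterval y 0 T := hy ▸ hA.exp.mul hcB
  refine ⟨hyAC.continuousOn, fun s hs t ht ↦ ?_⟩
  have hsub : uIcc s t ⊆ uIcc 0 T := uIcc_subset_uIcc hs ht
  rw [← (hyAC.mono hsub).integral_deriv_eq_sub]
  refine intervalIntegral.integral_congr_ae ?_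
  filter_upwards [ha.ae_hasDerivAt_integral, hbE.ae_hasDerivAt_integral] with x hax hbx hx
  have hx' := hsub (uIoc_subset_uIcc hx)
  have h := (hax hx' 0 left_mem_uIcc).exp.mul ((hbx hx' 0 left_mem_uIcc).const_add c)
  rw [hy]
  refine h.deriv.trans ?_
  have := Real.exp_ne_zero (∫ r in (0:ℝ)..x, a r)
  simp only [Real.exp_neg]
  field_simp

/-- An integral inequality `w t - w s ≤ ∫ₛᵗ a w` preserves nonpositivity. -/
theorem nonpos_of_sub_le_integral_mul {a w : ℝ → ℝ} {T : ℝ} (hT : 0 ≤ T)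
    (ha : IntervalIntegrable a volume 0 T) (hw : ContinuousOn w (Icc 0 T)) (h0 : w 0 ≤ 0)
    (h : ∀ s t, 0 ≤ s → s ≤ t → t ≤ T → w t - w s ≤ ∫ x in s..t, a x * w x) : w T ≤ 0 := by
  by_contra! hwT
  obtain ⟨s, ⟨hs, hws⟩, hsmax⟩ : ∃ s, IsGreatest (Icc 0 T ∩ w ⁻¹' Iic 0) s :=
    (isCompact_Icc.of_isClosed_subset (hw.preimage_isClosed_of_isClosed isClosed_Icc isClosed_Iic)
      inter_subset_left).exists_isGreatest ⟨0, ⟨le_rfl, hT⟩, h0⟩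
  have hws : w s ≤ 0 := hws
  have hpos : ∀ r, s < r → r ≤ T → 0 < w r := fun r hr hrT ↦ by
    by_contra! hle
    exact absurd (hsmax ⟨⟨hs.1.trans hr.le, hrT⟩, hle⟩) (not_le.2 hr)
  have hsT : s < T := hs.2.lt_of_ne fun e ↦ by subst e; linarith
  have hasub : ∀ p q, s ≤ p → p ≤ q → q ≤ T → IntervalIntegrable a volume p q :=
    fun p q hp hpq hq ↦ ha.mono_set (by
      rw [uIcc_of_le hpq, uIcc_of_le hT]; exact Icc_subset_Icc (hs.1.trans hp) hq)
  obtain ⟨r, ⟨hsr, hrT⟩, hr⟩ : ∃ r ∈ Ioc s T, ∫ x in s..r, |a x| < 1 := by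
    have hc := continuousOn_primitive_interval' (hasub s T le_rfl hsT.le le_rfl).abs left_mem_uIcc
    have ht := (hc s left_mem_uIcc).tendsto
    rw [uIcc_of_le hsT.le, integral_same] at ht
    have ht' := ht.mono_left (nhdsWithin_mono s (Ioc_subset_Icc_self))
    rw [nhdsWithin_Ioc_eq_nhdsGT hsT] at ht'
    have hmem : ∀ᶠ r in 𝓝[>] s, r ∈ Ioc s T := Ioc_mem_nhdsGT hsT
    exact (hmem.and (ht'.eventually (gt_mem_nhds one_pos))).exists
  obtain ⟨m, hm, hmax⟩ := isCompact_Icc.exists_isMaxOn (nonempty_Icc.2 hsr.le)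
    (hw.mono (Icc_subset_Icc hs.1 hrT))
  have hwm : 0 < w m := (hpos r hsr hrT).trans_le (hmax (right_mem_Icc.2 hsr.le))
  have hai := hasub s m le_rfl hm.1 (hm.2.trans hrT)
  have h1 : ∫ x in s..m, a x * w x ≤ ∫ x in s..m, |a x| * w m := by
    refine integral_mono_on_of_le_Ioo hm.1 ?_ (hai.abs.mul_const _) fun x hx ↦ ?_
    · refine hai.mul_continuousOn (hw.mono ?_)
      rw [uIcc_of_le hm.1]
      exact Icc_subset_Icc hs.1 (hm.2.trans hrT)
    · have hxr : x ≤ r := hx.2.le.trans hm.2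
      exact mul_le_mul (le_abs_self _) (hmax ⟨hx.1.le, hxr⟩) (hpos x hx.1 (hxr.trans hrT)).le
        (abs_nonneg _)
  have h2 : ∫ x in s..m, |a x| ≤ ∫ x in s..r, |a x| :=
    integral_mono_interval le_rfl hm.1 hm.2 (ae_of_all _ fun _ ↦ abs_nonneg _)
      (hasub s r le_rfl hsr.le hrT).abs
  rw [intervalIntegral.integral_mul_const] at h1
  nlinarith [h s m hs.1 hm.1 (hm.2.trans hrT)]

/-- A smooth function supported in `[s + ε, t + 2 ε]`, approximating the indicator of `(s, t]`. -/
noncomputable def smoothIndicator (s t ε x : ℝ) : ℝ :=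
  Real.smoothTransition ((x - s) / ε - 1) - Real.smoothTransition ((x - t) / ε - 1)

theorem contDiff_smoothIndicator (s t ε : ℝ) {n : ℕ∞} : ContDiff ℝ n (smoothIndicator s t ε) := by
  have h (u : ℝ) : ContDiff ℝ n fun x : ℝ ↦ (x - u) / ε - 1 := by fun_prop
  exact (Real.smoothTransition.contDiff.comp (h s)).sub (Real.smoothTransition.contDiff.comp (h t))

theorem smoothIndicator_nonneg {s t ε : ℝ} (hst : s ≤ t) (hε : 0 < ε) (x : ℝ) :
    0 ≤ smoothIndicator s t ε x :=
  sub_nonneg.2 <| Real.smoothTransition.monotone (by gcongr)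

theorem smoothIndicator_le_one (s t ε x : ℝ) : smoothIndicator s t ε x ≤ 1 := by
  have := Real.smoothTransition.le_one ((x - s) / ε - 1)
  have := Real.smoothTransition.nonneg ((x - t) / ε - 1)
  unfold smoothIndicator
  linarith

theorem smoothIndicator_eq_zero_of_notMem {s t ε x : ℝ} (hst : s ≤ t) (hε : 0 < ε)
    (hx : x ∉ Icc (s + ε) (t + 2 * ε)) : smoothIndicator s t ε x = 0 := by
  unfold smoothIndicator
  rw [mem_Icc, not_and_or, not_le, not_le] at hx
  rcases hx with hx | hx
  · rw [Real.smoothTransition.zero_of_nonpos, Real.smoothTransition.zero_of_nonpos, sub_zero]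
    · rw [sub_nonpos, div_le_one hε]; linarith
    · rw [sub_nonpos, div_le_one hε]; linarith
  · rw [Real.smoothTransition.one_of_one_le, Real.smoothTransition.one_of_one_le, sub_self]
    · rw [le_sub_iff_add_le, le_div_iff₀ hε]; linarith
    · rw [le_sub_iff_add_le, le_div_iff₀ hε]; linarith

theorem tsupport_smoothIndicator_subset {s t ε : ℝ} (hst : s ≤ t) (hε : 0 < ε) :
    tsupport (smoothIndicator s t ε) ⊆ Icc (s + ε) (t + 2 * ε) :=
  closure_minimal (fun _ hx ↦ by_contra fun h ↦ hx (smoothIndicator_eq_zero_of_notMem hst hε h))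
    isClosed_Icc

theorem tendsto_smoothTransition_div (u x : ℝ) :
    Tendsto (fun ε ↦ Real.smoothTransition ((x - u) / ε - 1)) (𝓝[>] 0)
      (𝓝 ((Ioi u).indicator 1 x)) := by
  refine tendsto_const_nhds.congr' ?_
  by_cases hx : u < x
  · filter_upwards [Ioc_mem_nhdsGT (show 0 < (x - u) / 2 by linarith)] with ε hε
    rw [indicator_of_mem (mem_Ioi.2 hx), Real.smoothTransition.one_of_one_le, Pi.one_apply]
    rw [le_sub_iff_add_le, le_div_iff₀ hε.1]
    linarith [hε.2]
  · filter_upwards [self_mem_nhdsWithin] with ε hε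
    rw [indicator_of_notMem (by simpa using hx), Real.smoothTransition.zero_of_nonpos]
    linarith [div_nonpos_of_nonpos_of_nonneg (sub_nonpos.2 (not_lt.1 hx)) (le_of_lt hε)]

theorem tendsto_smoothIndicator {s t : ℝ} (hst : s ≤ t) (x : ℝ) :
    Tendsto (fun ε ↦ smoothIndicator s t ε x) (𝓝[>] 0) (𝓝 ((Ioc s t).indicator 1 x)) := by
  have h : (Ioc s t).indicator (1 : ℝ → ℝ) x =
      (Ioi s).indicator 1 x - (Ioi t).indicator 1 x := by
    simp only [indicator, mem_Ioc, mem_Ioi, Pi.one_apply]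
    grind
  rw [h]
  exact (tendsto_smoothTransition_div s x).sub (tendsto_smoothTransition_div t x)

theorem deriv_smoothTransition_eq_zero_of_notMem {x : ℝ} (hx : x ∉ Ioc (0 : ℝ) 1) :
    deriv Real.smoothTransition x = 0 := by
  by_cases h : x ≤ 0
  · have hmin : IsLocalMin Real.smoothTransition x := Eventually.of_forall fun y ↦ by
      rw [Real.smoothTransition.zero_of_nonpos h]; exact Real.smoothTransition.nonneg y
    exact hmin.deriv_eq_zero
  · have hmax : IsLocalMax Real.smoothTransition x := Eventually.of_forall fun y ↦ by
      have hx1 : 1 ≤ x := by rw [mem_Ioc] at hx; grind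
      rw [Real.smoothTransition.one_of_one_le hx1]; exact Real.smoothTransition.le_one y
    exact hmax.deriv_eq_zero

theorem continuous_deriv_smoothTransition : Continuous (deriv Real.smoothTransition) :=
  (Real.smoothTransition.contDiff (n := 1)).continuous_deriv le_rfl

theorem hasDerivAt_smoothTransition_div (u ε x : ℝ) :
    HasDerivAt (fun x ↦ Real.smoothTransition ((x - u) / ε - 1))
      (deriv Real.smoothTransition ((x - u) / ε - 1) / ε) x := by
  have h1 : HasDerivAt (fun x : ℝ ↦ (x - u) / ε - 1) (1 / ε) x :=
    (((hasDerivAt_id x).sub_const u).div_const ε).sub_const 1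
  have h2 := ((Real.smoothTransition.contDiff (n := 1)).differentiable one_ne_zero
    ((x - u) / ε - 1)).hasDerivAt
  exact (h2.comp x h1).congr_deriv (mul_one_div _ _)

theorem integral_mul_deriv_smoothTransition_div (F : ℝ → ℝ) (u : ℝ) {ε : ℝ} (hε : 0 < ε) :
    ∫ x, F x * (deriv Real.smoothTransition ((x - u) / ε - 1) / ε) =
      ∫ y in (0 : ℝ)..1, F (u + ε * (y + 1)) * deriv Real.smoothTransition y := by
  have h1 : ∀ x, F x * (deriv Real.smoothTransition ((x - u) / ε - 1) / ε) =
      (fun z ↦ (fun v ↦ (fun y ↦ ε⁻¹ * (F (u + ε * (y + 1)) * deriv Real.smoothTransition y))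
        (v - 1)) (z / ε)) (x - u) := fun x ↦ by
    have : u + ε * ((x - u) / ε - 1 + 1) = x := by field_simp; ring
    simp only [this]
    ring
  simp_rw [h1]
  rw [integral_sub_right_eq_self (fun z ↦ (fun v ↦ (fun y ↦ ε⁻¹ *
    (F (u + ε * (y + 1)) * deriv Real.smoothTransition y)) (v - 1)) (z / ε)) u,
    Measure.integral_comp_div (fun v ↦ (fun y ↦ ε⁻¹ *
    (F (u + ε * (y + 1)) * deriv Real.smoothTransition y)) (v - 1)) ε,
    integral_sub_right_eq_self (fun y ↦ ε⁻¹ *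
    (F (u + ε * (y + 1)) * deriv Real.smoothTransition y)) 1, MeasureTheory.integral_const_mul,
    abs_of_pos hε, smul_eq_mul, mul_inv_cancel_left₀ hε.ne',
    intervalIntegral.integral_of_le zero_le_one]
  refine (setIntegral_eq_integral_of_forall_compl_eq_zero fun y hy ↦ ?_).symm
  rw [deriv_smoothTransition_eq_zero_of_notMem hy, mul_zero]

theorem tendsto_integral_mul_deriv_smoothTransition_div {F : ℝ → ℝ} (hF : Continuous F) (u : ℝ) :
    Tendsto (fun ε ↦ ∫ x, F x * (deriv Real.smoothTransition ((x - u) / ε - 1) / ε)) (𝓝[>] 0)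
      (𝓝 (F u)) := by
  have hc : Continuous fun ε : ℝ ↦
      ∫ y in (0 : ℝ)..1, F (u + ε * (y + 1)) * deriv Real.smoothTransition y := by
    refine continuous_parametric_intervalIntegral_of_continuous' ?_ 0 1
    have := continuous_deriv_smoothTransition
    unfold Function.uncurry
    fun_prop
  have h0 : ∫ y in (0 : ℝ)..1, F (u + 0 * (y + 1)) * deriv Real.smoothTransition y = F u := by
    simp only [zero_mul, add_zero, intervalIntegral.integral_const_mul]
    rw [integral_deriv_eq_sub
      (fun x _ ↦ (Real.smoothTransition.contDiff (n := 1)).differentiable one_ne_zero x)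
      (continuous_deriv_smoothTransition.intervalIntegrable 0 1)]
    simp
  have ht := (hc.tendsto 0).mono_left (nhdsWithin_le_nhds (s := Ioi 0))
  rw [h0] at ht
  refine ht.congr' ?_
  filter_upwards [self_mem_nhdsWithin] with ε hε
  exact (integral_mul_deriv_smoothTransition_div F u hε).symm

theorem tendsto_integral_mul_deriv_smoothIndicator {F : ℝ → ℝ} (hF : Continuous F) (s t : ℝ) :
    Tendsto (fun ε ↦ ∫ x, F x * deriv (smoothIndicator s t ε) x) (𝓝[>] 0) (𝓝 (F s - F t)) := by
  refine ((tendsto_integral_mul_deriv_smoothTransition_div hF s).sub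
    (tendsto_integral_mul_deriv_smoothTransition_div hF t)).congr' ?_
  filter_upwards [self_mem_nhdsWithin] with ε hε
  have hε : 0 < ε := hε
  have hint (u : ℝ) :
      Integrable fun x ↦ F x * (deriv Real.smoothTransition ((x - u) / ε - 1) / ε) := by
    refine Continuous.integrable_of_hasCompactSupport ?_
      (HasCompactSupport.intro (isCompact_Icc (a := u) (b := u + 2 * ε)) fun x hx ↦ ?_)
    · have := continuous_deriv_smoothTransition
      fun_prop
    · rw [deriv_smoothTransition_eq_zero_of_notMem, zero_div, mul_zero]
      contrapose! hx
      obtain ⟨h1, h2⟩ := hx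
      rw [sub_pos, lt_div_iff₀ hε] at h1
      rw [sub_le_iff_le_add, div_le_iff₀ hε] at h2
      constructor <;> linarith
  rw [← MeasureTheory.integral_sub (hint s) (hint t)]
  congr 1 with x
  rw [← mul_sub, ((hasDerivAt_smoothTransition_div s ε x).sub
    (hasDerivAt_smoothTransition_div t ε x)).deriv.symm]
  rfl

theorem tendsto_setIntegral_mul_smoothIndicator {g : ℝ → ℝ}
    (hg : LocallyIntegrableOn g (Ici 0)) {s t : ℝ} (hs : 0 ≤ s) (hst : s ≤ t) :
    Tendsto (fun ε ↦ ∫ x in Ioi (0 : ℝ), g x * smoothIndicator s t ε x) (𝓝[>] 0)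
      (𝓝 (∫ x in s..t, g x)) := by
  have hlim : ∫ x in s..t, g x = ∫ x in Ioc 0 (t + 2), g x * (Ioc s t).indicator 1 x := by
    have : ∀ x, g x * (Ioc s t).indicator 1 x = (Ioc s t).indicator g x := fun x ↦ by
      by_cases hx : x ∈ Ioc s t <;> simp [hx]
    simp_rw [this]
    rw [setIntegral_indicator measurableSet_Ioc, intervalIntegral.integral_of_le hst,
      inter_eq_self_of_subset_right (Ioc_subset_Ioc hs (by linarith))]
  have hgi : IntegrableOn g (Ioc 0 (t + 2)) :=
    (hg.integrableOn_compact_subset Icc_subset_Ici_self isCompact_Icc).mono_set Ioc_subset_Icc_self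
  rw [hlim]
  have hdct : Tendsto (fun ε ↦ ∫ x in Ioc 0 (t + 2), g x * smoothIndicator s t ε x) (𝓝[>] 0)
      (𝓝 (∫ x in Ioc 0 (t + 2), g x * (Ioc s t).indicator 1 x)) := by
    refine tendsto_integral_filter_of_dominated_convergence (fun x ↦ ‖g x‖) ?_ ?_ hgi.norm ?_
    · exact Eventually.of_forall fun ε ↦ hgi.aestronglyMeasurable.mul
        (contDiff_smoothIndicator s t ε (n := 0)).continuous.aestronglyMeasurable
    · filter_upwards [self_mem_nhdsWithin] with ε hε
      refine ae_of_all _ fun x ↦ ?_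
      rw [norm_mul]
      refine mul_le_of_le_one_right (norm_nonneg _) ?_
      rw [Real.norm_of_nonneg (smoothIndicator_nonneg hst hε x)]
      exact smoothIndicator_le_one s t ε x
    · exact ae_of_all _ fun x ↦ (tendsto_smoothIndicator hst x).const_mul _
  refine hdct.congr' ?_
  filter_upwards [Ioc_mem_nhdsGT one_pos] with ε hε
  refine setIntegral_eq_of_subset_of_forall_sdiff_eq_zero measurableSet_Ioi Ioc_subset_Ioi_self
    (fun x hx ↦ ?_) |>.symm
  rw [smoothIndicator_eq_zero_of_notMem hst hε.1, mul_zero]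
  intro hx'
  exact hx.2 ⟨hx.1, by linarith [hx'.2, hε.2]⟩

/-- A continuous function with `f' ≤ g` in the distributional sense on `(0, ∞)` satisfies the
integrated inequality on `[0, ∞)`. -/
theorem sub_le_integral_of_distributional_deriv_le {f g : ℝ → ℝ} (hf : ContinuousOn f (Ici 0))
    (hg : LocallyIntegrableOn g (Ici 0))
    (h : ∀ φ : ℝ → ℝ, ContDiff ℝ (⊤ : ℕ∞) φ → HasCompactSupport φ →
      tsupport φ ⊆ Ioi 0 → (∀ t, 0 ≤ φ t) →
      -(∫ t in Ioi (0:ℝ), f t * deriv φ t) ≤ ∫ t in Ioi (0:ℝ), g t * φ t)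
    {s t : ℝ} (hs : 0 ≤ s) (hst : s ≤ t) : f t - f s ≤ ∫ x in s..t, g x := by
  set F : ℝ → ℝ := fun x ↦ f (max x 0) with hFdef
  have hF : Continuous F := hf.comp_continuous (by fun_prop) fun x ↦ le_max_right x 0
  have hFf {x : ℝ} (hx : 0 ≤ x) : F x = f x := by simp [hFdef, hx]
  have hlim := (tendsto_integral_mul_deriv_smoothIndicator hF s t).neg
  rw [hFf hs, hFf (hs.trans hst), neg_sub] at hlim
  refine le_of_tendsto_of_tendsto hlim (tendsto_setIntegral_mul_smoothIndicator hg hs hst) ?_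
  filter_upwards [self_mem_nhdsWithin] with ε hε
  have hε : 0 < ε := hε
  have hsupp := tsupport_smoothIndicator_subset hst hε
  have hpos : Icc (s + ε) (t + 2 * ε) ⊆ Ioi 0 := fun x hx ↦ by
    have := hx.1
    rw [mem_Ioi]
    linarith
  refine le_of_eq_of_le ?_ (h _ (contDiff_smoothIndicator s t ε)
    (isCompact_Icc.of_isClosed_subset (isClosed_tsupport _) hsupp) (hsupp.trans hpos)
    (smoothIndicator_nonneg hst hε))
  rw [neg_inj, ← setIntegral_eq_integral_of_forall_compl_eq_zero (s := Ioi 0)]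
  · exact setIntegral_congr_fun measurableSet_Ioi fun x hx ↦ by simp only [hFf (le_of_lt hx)]
  · intro x hx
    have : deriv (smoothIndicator s t ε) x = 0 := by
      by_contra hne
      exact hx (hpos (hsupp (support_deriv_subset hne)))
    rw [this, mul_zero]

/-- Differential form of Grönwall's lemma (Lemma B.1): if `f` is continuous on `[0,∞)` and
`f' ≤ a f + b` holds distributionally on `(0,∞)` (tested against nonnegative smooth functions
compactly supported in `(0,∞)`), with `a, b` locally integrable on `[0,∞)`, then
`f t ≤ e^{A(t)} (f 0 + ∫₀ᵗ b(s) e^{-A(s)} ds)` where `A(t) = ∫₀ᵗ a`. -/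
theorem stmt12 (f a b : ℝ → ℝ)
    (hf : ContinuousOn f (Set.Ici 0))
    (ha : LocallyIntegrableOn a (Set.Ici 0))
    (hb : LocallyIntegrableOn b (Set.Ici 0))
    (hdistr : ∀ φ : ℝ → ℝ, ContDiff ℝ (⊤ : ℕ∞) φ → HasCompactSupport φ →
      tsupport φ ⊆ Set.Ioi 0 → (∀ t, 0 ≤ φ t) →
      -(∫ t in Set.Ioi (0:ℝ), f t * deriv φ t) ≤
        ∫ t in Set.Ioi (0:ℝ), (a t * f t + b t) * φ t) :
    ∀ t ≥ (0:ℝ), f t ≤ Real.exp (∫ s in (0:ℝ)..t, a s) *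
      (f 0 + ∫ s in (0:ℝ)..t, b s * Real.exp (-(∫ r in (0:ℝ)..s, a r))) := by
  intro T hT
  have hInt {g : ℝ → ℝ} (hg : LocallyIntegrableOn g (Ici 0)) {s t : ℝ} (hs : 0 ≤ s)
      (hst : s ≤ t) : IntervalIntegrable g volume s t :=
    (intervalIntegrable_iff_integrableOn_Icc_of_le hst).2
      (hg.integrableOn_compact_subset (fun x hx ↦ hs.trans hx.1) isCompact_Icc)
  have hg : LocallyIntegrableOn (fun t ↦ a t * f t + b t) (Ici 0) :=
    (ha.mul_continuousOn hf isClosed_Ici.isLocallyClosed).add hb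
  obtain ⟨y, hy⟩ : ∃ y : ℝ → ℝ, y = fun t ↦ Real.exp (∫ s in (0:ℝ)..t, a s) *
    (f 0 + ∫ s in (0:ℝ)..t, b s * Real.exp (-(∫ r in (0:ℝ)..s, a r))) := ⟨_, rfl⟩
  obtain ⟨hyc, hyeq⟩ := variation_of_constants_sub_eq_integral (hInt ha le_rfl hT)
    (hInt hb le_rfl hT) hy
  rw [uIcc_of_le hT] at hyc hyeq
  have key : f T - y T ≤ 0 := by
    refine nonpos_of_sub_le_integral_mul (w := fun t ↦ f t - y t) hT (hInt ha le_rfl hT)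
      ((hf.mono Icc_subset_Ici_self).sub hyc) (by simp [hy]) fun s t hs hst ht ↦ ?_
    have h1 := sub_le_integral_of_distributional_deriv_le hf hg hdistr hs hst
    have h2 := hyeq s ⟨hs, hst.trans ht⟩ t ⟨hs.trans hst, ht⟩
    have hay : IntervalIntegrable (fun x ↦ a x * y x + b x) volume s t := by
      refine ((hInt ha hs hst).mul_continuousOn (hyc.mono ?_)).add (hInt hb hs hst)
      rw [uIcc_of_le hst]
      exact Icc_subset_Icc hs ht
    calc f t - y t - (f s - y s) ≤
        (∫ x in s..t, (a x * f x + b x)) - ∫ x in s..t, (a x * y x + b x) := by linarith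
      _ = ∫ x in s..t, a x * (f x - y x) := by
        rw [← intervalIntegral.integral_sub (hInt hg hs hst) hay]
        congr 1 with x
        ring
  rw [hy] at key
  exact sub_nonpos.1 key
end

section
/- Let f : [0,∞) → ℝ be continuous and nonnegative, and let C₁, C₂ > 0 be constants such that f(t) ≤ f(s) − C₁ ∫_s^t f(r) dr + C₂ (t − s) for all 0 ≤ s ≤ t. Then f(t) ≤ C₂/C₁ + e^{−C₁ t} · f(0) for every t ≥ 0. -/
open MeasureTheory intervalIntegral

/-- The right derivative of the integral of a function continuous on `[a, ∞)`. -/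
theorem hasDerivWithinAt_integral_Ioi_of_continuousOn_Ici {f : ℝ → ℝ} {a x : ℝ}
    (hf : ContinuousOn f (Set.Ici a)) (hx : a ≤ x) :
    HasDerivWithinAt (fun z => ∫ r in x..z, f r) (f x) (Set.Ioi x) x := by
  have hsub : Set.Ioi x ⊆ Set.Ici a := fun y hy => hx.trans (le_of_lt hy)
  exact (integral_hasDerivWithinAt_right (s := Set.Ici x) (t := Set.Ioi x)
    IntervalIntegrable.refl
    ((hf.mono hsub).stronglyMeasurableAtFilter_nhdsWithin measurableSet_Ioi x)
    ((hf x hx).mono hsub)).mono Set.Ioi_subset_Ici_self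

/-- Integral form of Grönwall's lemma (Lemma B.2): if `f ≥ 0` is continuous on `[0,∞)` and
`f t ≤ f s - C₁ ∫ₛᵗ f + C₂ (t - s)` for all `0 ≤ s ≤ t`, then
`f t ≤ C₂/C₁ + e^{-C₁ t} f 0` for all `t ≥ 0`. -/
theorem stmt14 (f : ℝ → ℝ) (hf : ContinuousOn f (Set.Ici 0))
    (hpos : ∀ t ≥ (0:ℝ), 0 ≤ f t)
    (C₁ C₂ : ℝ) (hC₁ : 0 < C₁) (hC₂ : 0 < C₂)
    (h : ∀ s t : ℝ, 0 ≤ s → s ≤ t →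
      f t ≤ f s - C₁ * (∫ r in s..t, f r) + C₂ * (t - s)) :
    ∀ t ≥ (0:ℝ), f t ≤ C₂ / C₁ + Real.exp (-(C₁ * t)) * f 0 := by
  intro t ht
  have key := le_gronwallBound_of_liminf_deriv_right_le
    (f' := fun x => -C₁ * f x + C₂) (δ := f 0) (K := -C₁) (ε := C₂) (b := t)
    (hf.mono Set.Icc_subset_Ici_self) (fun x hx r hr => by
      have hderiv : HasDerivWithinAt (fun z => -C₁ * (∫ r in x..z, f r) + C₂ * (z - x))
          (-C₁ * f x + C₂ * 1) (Set.Ioi x) x :=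
        ((hasDerivWithinAt_integral_Ioi_of_continuousOn_Ici hf hx.1).const_mul _).add
          (((hasDerivWithinAt_id x _).sub_const x).const_mul C₂)
      rw [hasDerivWithinAt_iff_tendsto_slope' Set.self_notMem_Ioi] at hderiv
      refine Filter.Eventually.frequently ?_
      filter_upwards [hderiv.eventually_lt_const (by simpa using hr), self_mem_nhdsWithin]
        with z hz hxz
      refine lt_of_le_of_lt ?_ hz
      have hxz' : x < z := hxz
      simp only [slope, vsub_eq_sub, smul_eq_mul, integral_same, sub_self, mul_zero, add_zero,
        sub_zero]
      have := h x z hx.1 hxz'.le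
      exact mul_le_mul_of_nonneg_left (by linarith) (inv_nonneg.2 (sub_nonneg.2 hxz'.le)))
    le_rfl (fun _ _ => le_rfl) t ⟨ht, le_rfl⟩
  simp only [gronwallBound_of_K_ne_0 (neg_ne_zero.2 hC₁.ne'), sub_zero, neg_mul, div_neg] at key
  have : 0 ≤ C₂ / C₁ * Real.exp (-(C₁ * t)) := by positivity
  linarith
end
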